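/- Let 0 < k < N and let C ⊆ {0,1}^N be a cylinder set of dimension k+1, i.e., C = {x : x_j = y_j for all j ∉ λ} for some λ ⊆ {1,…,N} with |λ| = k+1 and some y ∈ {0,1}^N. For every Z ⊆ C: Z is an S-set for the k-interaction exponential family E^k (every probability distribution with support ⊆ Z lies in the closure of E^k) if and only if C ∩ Z_+ ⊄ Z and C ∩ Z_− ⊄ Z. Consequently, the number of S-sets Z ⊆ C with |Z| = 2^{k+1} − 2 is exactly 2^{2k}. -/

import Mathlib

/-- A probability distribution on a finite set `X`. -/
def IsDist {X : Type*} [Fintype X] (p : X → ℝ) : Prop :=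
  (∀ x, 0 ≤ p x) ∧ ∑ x, p x = 1

/-- `g` depends only on the coordinates in `s`. -/
def DependsOnlyOn {N : ℕ} {X : Fin N → Type*} (s : Finset (Fin N))
    (g : ((i : Fin N) → X i) → ℝ) : Prop :=
  ∀ x y, (∀ i ∈ s, x i = y i) → g x = g y

/-- The `k`-interaction exponential family on `X = X_1 × ⋯ × X_N`. -/
def interactionFamily (k : ℕ) {N : ℕ} {X : Fin N → Type*} [∀ i, Fintype (X i)] :
    Set (((i : Fin N) → X i) → ℝ) :=
  {p | ∃ F : Finset (Fin N) → ((i : Fin N) → X i) → ℝ,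
    (∀ s, DependsOnlyOn s (F s)) ∧ (∀ s, k < s.card → F s = 0) ∧
    ∀ x, p x = Real.exp (∑ s, F s x) / ∑ y, Real.exp (∑ s, F s y)}

/-- The `k`-interaction exponential family on `{0,1}^N`. -/
abbrev EkBin (N k : ℕ) : Set ((Fin N → Fin 2) → ℝ) := interactionFamily k

/-- `Y` is an S-set for the family `E`: every distribution supported in `Y`
lies in the closure of `E`. -/
def IsSSet {X : Type*} [Fintype X] (E : Set (X → ℝ)) (Y : Set X) : Prop :=
  ∀ p : X → ℝ, IsDist p → {x | 0 < p x} ⊆ Y → p ∈ closure E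

/-- The set of even-parity binary vectors. -/
def Zplus (N : ℕ) : Set (Fin N → Fin 2) := {x | Even (∑ i, (x i : ℕ))}

/-- The set of odd-parity binary vectors. -/
def Zminus (N : ℕ) : Set (Fin N → Fin 2) := {x | ¬ Even (∑ i, (x i : ℕ))}


/-- The functions that are sums of interactions of order at most `k`. -/
def interactionSpace (k N : ℕ) : Submodule ℝ ((Fin N → Fin 2) → ℝ) where
  carrier := {h | ∃ F : Finset (Fin N) → (Fin N → Fin 2) → ℝ,
    (∀ s, DependsOnlyOn s (F s)) ∧ (∀ s, k < s.card → F s = 0) ∧ ∀ x, h x = ∑ s, F s x}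
  zero_mem' := ⟨0, fun _ _ _ _ => rfl, fun _ _ => rfl, fun _ => by simp⟩
  add_mem' := by
    rintro a b ⟨F, hF, hF', hFa⟩ ⟨G, hG, hG', hGb⟩
    refine ⟨F + G, fun s x y h => ?_, fun s h => ?_, fun x => ?_⟩
    · simp [hF s x y h, hG s x y h]
    · simp [hF' s h, hG' s h]
    · simp [hFa x, hGb x, Finset.sum_add_distrib]
  smul_mem' := by
    rintro c a ⟨F, hF, hF', hFa⟩
    refine ⟨c • F, fun s x y h => ?_, fun s h => ?_, fun x => ?_⟩
    · simp [hF s x y h]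
    · rw [Pi.smul_apply, hF' s h, smul_zero]
    · simp [hFa x, Finset.mul_sum]

theorem DependsOnlyOn.mem_interactionSpace {k N : ℕ} {s : Finset (Fin N)}
    {g : (Fin N → Fin 2) → ℝ} (hg : DependsOnlyOn s g) (hs : s.card ≤ k) :
    g ∈ interactionSpace k N := by
  refine ⟨fun t => if t = s then g else 0, fun t x y h => ?_, fun t h => ?_, fun x => ?_⟩
  · by_cases hts : t = s
    · subst hts; simpa using hg x y h
    · simp [hts]
  · have : t ≠ s := by rintro rfl; omega
    simp [this]
  · rw [Finset.sum_eq_single s] <;> simp +contextual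

theorem mem_EkBin_of_mem_interactionSpace {k N : ℕ} {h : (Fin N → Fin 2) → ℝ}
    (hh : h ∈ interactionSpace k N) :
    (fun x => Real.exp (h x) / ∑ z, Real.exp (h z)) ∈ EkBin N k := by
  obtain ⟨F, hF, hF', hFa⟩ := hh
  exact ⟨F, hF, hF', fun x => by simp only [hFa]⟩

theorem exists_mem_interactionSpace_of_mem_EkBin {k N : ℕ} {p : (Fin N → Fin 2) → ℝ}
    (hp : p ∈ EkBin N k) : ∃ h ∈ interactionSpace k N, ∀ x, p x = Real.exp (h x) := by
  obtain ⟨F, hF, hF', hFp⟩ := hp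
  set W := ∑ z, Real.exp (∑ s, F s z) with hW
  have hWpos : 0 < W := Finset.sum_pos (fun _ _ => Real.exp_pos _) Finset.univ_nonempty
  have hc : DependsOnlyOn (∅ : Finset (Fin N)) (fun _ : Fin N → Fin 2 => Real.log W) :=
    fun _ _ _ => rfl
  refine ⟨(fun x => ∑ s, F s x) - fun _ => Real.log W,
    Submodule.sub_mem _ ⟨F, hF, hF', fun _ => rfl⟩ (hc.mem_interactionSpace (by simp)),
    fun x => ?_⟩
  simp [hFp x, Real.exp_sub, Real.exp_log hWpos]

/-- The character `(-1)^(x_1 + ⋯ + x_N)`. -/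
def paritySign {N : ℕ} (x : Fin N → Fin 2) : ℝ := ∏ i, (-1) ^ (x i : ℕ)

open Classical in
theorem paritySign_eq {N : ℕ} (x : Fin N → Fin 2) :
    paritySign x = if x ∈ Zplus N then 1 else -1 := by
  rw [paritySign, Finset.prod_pow_eq_pow_sum]
  split_ifs with h
  · exact Even.neg_one_pow h
  · exact Odd.neg_one_pow (Nat.not_even_iff_odd.mp h)

theorem paritySign_mul_self {N : ℕ} (x : Fin N → Fin 2) : paritySign x * paritySign x = 1 := by
  rw [paritySign_eq]; split_ifs <;> norm_num

theorem neg_one_pow_val_of_ne {a b : Fin 2} (h : a ≠ b) :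
    (-1 : ℝ) ^ (a : ℕ) = -(-1) ^ (b : ℕ) := by
  fin_cases a <;> fin_cases b <;> simp_all

theorem paritySign_update {N : ℕ} (x : Fin N → Fin 2) (i : Fin N) :
    paritySign (Function.update x i (x i + 1)) = -paritySign x := by
  rw [paritySign, paritySign, ← Finset.mul_prod_erase _ _ (Finset.mem_univ i),
    ← Finset.mul_prod_erase _ (fun j => (-1 : ℝ) ^ (x j : ℕ)) (Finset.mem_univ i), ← neg_mul]
  congr 1
  · rw [Function.update_self]
    exact neg_one_pow_val_of_ne (by generalize x i = a; revert a; decide)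
  · refine Finset.prod_congr rfl fun j hj => ?_
    rw [Function.update_of_ne (Finset.ne_of_mem_erase hj)]

theorem paritySign_piecewise {N : ℕ} {s : Finset (Fin N)} {x y : Fin N → Fin 2}
    (h : ∀ i ∈ s, x i ≠ y i) :
    paritySign (s.piecewise x y) = (-1) ^ s.card * paritySign y := by
  rw [paritySign, paritySign, ← Finset.prod_mul_prod_compl s,
    ← Finset.prod_mul_prod_compl s (fun j => (-1 : ℝ) ^ (y j : ℕ)), ← mul_assoc]
  congr 1
  · rw [← Finset.prod_const, ← Finset.prod_mul_distrib]
    refine Finset.prod_congr rfl fun j hj => ?_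
    rw [Finset.piecewise_eq_of_mem _ _ _ hj, neg_one_pow_val_of_ne (h j hj)]
    ring
  · refine Finset.prod_congr rfl fun j hj => ?_
    rw [Finset.piecewise_eq_of_notMem _ _ _ (Finset.mem_compl.mp hj)]

/-- The cylinder set through `y` with free coordinates `lam`. -/
def cylinderFinset {N : ℕ} (lam : Finset (Fin N)) (y : Fin N → Fin 2) :
    Finset (Fin N → Fin 2) :=
  Finset.univ.filter fun x => ∀ j ∉ lam, x j = y j

theorem mem_cylinderFinset {N : ℕ} {lam : Finset (Fin N)} {x y : Fin N → Fin 2} :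
    x ∈ cylinderFinset lam y ↔ ∀ j ∉ lam, x j = y j := by
  simp [cylinderFinset]

theorem piecewise_mem_cylinderFinset {N : ℕ} {lam s : Finset (Fin N)} (hs : s ⊆ lam)
    (x y : Fin N → Fin 2) : s.piecewise x y ∈ cylinderFinset lam y :=
  mem_cylinderFinset.mpr fun _ hj =>
    Finset.piecewise_eq_of_notMem _ _ _ fun h => hj (hs h)

theorem piecewise_eq_of_mem_cylinderFinset {N : ℕ} {lam : Finset (Fin N)} {x y : Fin N → Fin 2}
    (hx : x ∈ cylinderFinset lam y) : lam.piecewise x y = x := by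
  funext j
  by_cases hj : j ∈ lam
  · simp [hj]
  · simp [hj, mem_cylinderFinset.mp hx j hj]

/-- Subsets of `lam` parametrize the cylinder set: flip the coordinates of `y` in the subset. -/
theorem sum_powerset_piecewise {N : ℕ} {M : Type*} [AddCommMonoid M] {lam : Finset (Fin N)}
    {x y : Fin N → Fin 2} (h : ∀ i ∈ lam, x i ≠ y i) (g : (Fin N → Fin 2) → M) :
    ∑ s ∈ lam.powerset, g (s.piecewise x y) = ∑ z ∈ cylinderFinset lam y, g z := by
  refine Finset.sum_nbij' (fun s => s.piecewise x y) (fun z => lam.filter fun i => z i ≠ y i)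
    (fun s hs => piecewise_mem_cylinderFinset (Finset.mem_powerset.mp hs) x y)
    (fun z _ => Finset.mem_powerset.mpr (Finset.filter_subset _ _)) (fun s hs => ?_)
    (fun z hz => ?_) (fun _ _ => rfl)
  · ext i
    have : i ∈ s → i ∈ lam := fun h => Finset.mem_powerset.mp hs h
    by_cases hi : i ∈ s
    · simp [hi, this hi, h i (this hi)]
    · simp [hi]
  · funext i
    by_cases hi : i ∈ lam
    · by_cases hzi : z i = y i
      · simp [hzi]
      · have := h i hi
        simp only [Finset.piecewise, Finset.mem_filter, hi, hzi, ne_eq, not_false_eq_true,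
          and_self, if_true]
        omega
    · simp [hi, mem_cylinderFinset.mp hz i hi]

theorem card_cylinderFinset {N : ℕ} (lam : Finset (Fin N)) (y : Fin N → Fin 2) :
    (cylinderFinset lam y).card = 2 ^ lam.card := by
  have := sum_powerset_piecewise (lam := lam) (x := fun i => y i + 1) (y := y)
    (fun i _ => by generalize y i = a; revert a; decide) (fun _ => 1)
  simpa using this.symm

theorem sum_paritySign_mul_eq_zero {N : ℕ} {lam : Finset (Fin N)} (y : Fin N → Fin 2)
    {i : Fin N} (hi : i ∈ lam) {g : (Fin N → Fin 2) → ℝ}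
    (hg : ∀ x, g (Function.update x i (x i + 1)) = g x) :
    ∑ x ∈ cylinderFinset lam y, paritySign x * g x = 0 := by
  have hne : ∀ a : Fin 2, a + 1 ≠ a := by decide
  have hinv : ∀ a : Fin 2, a + 1 + 1 = a := by decide
  refine Finset.sum_involution (fun x _ => Function.update x i (x i + 1)) (fun x _ => ?_)
    (fun x _ _ h => hne (x i) ?_) (fun x hx => ?_) (fun x _ => ?_)
  · rw [paritySign_update, hg]; ring
  · simpa using congrFun h i
  · refine mem_cylinderFinset.mpr fun j hj => ?_
    rw [Function.update_of_ne (by rintro rfl; exact hj hi)]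
    exact mem_cylinderFinset.mp hx j hj
  · simp [hinv]

theorem sum_paritySign_mul_eq_zero_of_mem_interactionSpace {k N : ℕ} {lam : Finset (Fin N)}
    (hlam : k < lam.card) (y : Fin N → Fin 2) {h : (Fin N → Fin 2) → ℝ}
    (hh : h ∈ interactionSpace k N) :
    ∑ x ∈ cylinderFinset lam y, paritySign x * h x = 0 := by
  obtain ⟨F, hF, hF', hFh⟩ := hh
  simp only [hFh, Finset.mul_sum]
  rw [Finset.sum_comm]
  refine Finset.sum_eq_zero fun s _ => ?_
  by_cases hs : k < s.card
  · simp [hF' s hs]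
  · obtain ⟨i, hi, his⟩ := Finset.exists_mem_notMem_of_card_lt_card
      (lt_of_le_of_lt (not_lt.mp hs) hlam)
    refine sum_paritySign_mul_eq_zero y hi fun x => hF s _ _ fun j hj => ?_
    rw [Function.update_of_ne (by rintro rfl; exact his hj)]

/-- The Möbius sum of a function orthogonal to the parity character vanishes. -/
theorem sum_powerset_neg_one_pow_mul_eq_zero {N : ℕ} {lam : Finset (Fin N)} {y : Fin N → Fin 2}
    {g : (Fin N → Fin 2) → ℝ} (hg : ∑ x ∈ cylinderFinset lam y, paritySign x * g x = 0)
    (x : Fin N → Fin 2) :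
    ∑ s ∈ lam.powerset, (-1) ^ s.card * g (s.piecewise x y) = 0 := by
  by_cases h : ∃ i ∈ lam, x i = y i
  · obtain ⟨i, hi, hxy⟩ := h
    rw [← Finset.insert_erase hi, Finset.sum_powerset_insert (Finset.notMem_erase i lam),
      ← Finset.sum_add_distrib]
    refine Finset.sum_eq_zero fun s hs => ?_
    have his : i ∉ s := fun h => Finset.notMem_erase i lam (Finset.mem_powerset.mp hs h)
    have : (insert i s).piecewise x y = s.piecewise x y := by
      rw [Finset.piecewise_insert, hxy, Function.update_eq_self_iff]
      simp [his]
    rw [this, Finset.card_insert_of_notMem his]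
    ring
  · push Not at h
    rw [← mul_zero (paritySign y), ← hg, ← sum_powerset_piecewise h, Finset.mul_sum]
    refine Finset.sum_congr rfl fun s hs => ?_
    rw [paritySign_piecewise fun i hi => h i (Finset.mem_powerset.mp hs hi)]
    linear_combination (-(-1) ^ s.card * g (s.piecewise x y)) * paritySign_mul_self y

theorem comp_piecewise_mem_interactionSpace {k N : ℕ} {lam : Finset (Fin N)}
    (hlam : lam.card ≤ k + 1) {y : Fin N → Fin 2} {g : (Fin N → Fin 2) → ℝ}
    (hg : ∑ x ∈ cylinderFinset lam y, paritySign x * g x = 0) :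
    (fun x => g (lam.piecewise x y)) ∈ interactionSpace k N := by
  have key : (fun x => g (lam.piecewise x y)) = (-(-1 : ℝ) ^ lam.card) •
      ∑ s ∈ lam.ssubsets, ((-1 : ℝ) ^ s.card • fun x => g (s.piecewise x y)) := by
    funext x
    have h := sum_powerset_neg_one_pow_mul_eq_zero hg x
    rw [← Finset.sum_erase_add _ _ (Finset.mem_powerset_self lam)] at h
    have hsq : ((-1 : ℝ) ^ lam.card) * (-1) ^ lam.card = 1 := by
      rw [← mul_pow]; simp
    simp only [Pi.smul_apply, Finset.sum_apply, smul_eq_mul, Finset.ssubsets]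
    linear_combination (-1) ^ lam.card * h - g (lam.piecewise x y) * hsq
  rw [key]
  refine Submodule.smul_mem _ _ (Submodule.sum_mem _ fun s hs => Submodule.smul_mem _ _ ?_)
  have hdep : DependsOnlyOn s fun x : Fin N → Fin 2 => g (s.piecewise x y) := fun a b hab => by
    have : s.piecewise a y = s.piecewise b y := by
      funext i
      by_cases hi : i ∈ s <;> simp [hi, hab]
    simp only [this]
  exact hdep.mem_interactionSpace
    (by have := Finset.card_lt_card (Finset.mem_ssubsets.mp hs); omega)

/-- A limit of Gibbs measures along a ray that concentrates on the support of `p`. -/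
theorem mem_closure_EkBin {k N : ℕ} {p u w : (Fin N → Fin 2) → ℝ} (hp : IsDist p)
    (hu : u ∈ interactionSpace k N) (hw : w ∈ interactionSpace k N)
    (hup : ∀ x, 0 < p x → u x = Real.log (p x)) (hwp : ∀ x, 0 < p x → w x = 0)
    (hwpos : ∀ x, p x = 0 → 0 < w x) : p ∈ closure (EkBin N k) := by
  have hlim : ∀ x, Filter.Tendsto (fun t : ℝ => Real.exp ((u - t • w) x)) Filter.atTop
      (nhds (p x)) := by
    intro x
    rcases (hp.1 x).eq_or_lt with h | h
    · rw [← h]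
      refine Real.tendsto_exp_atBot.comp ?_
      have : Filter.Tendsto (fun t : ℝ => t * w x) Filter.atTop Filter.atTop :=
        Filter.tendsto_id.atTop_mul_const (hwpos x h.symm)
      simpa [sub_eq_add_neg] using
        Filter.tendsto_atBot_add_const_left _ (u x) (Filter.tendsto_neg_atTop_atBot.comp this)
    · simp [hup x h, hwp x h, Real.exp_log h]
  have hsum := tendsto_finsetSum Finset.univ fun x _ => hlim x
  rw [hp.2] at hsum
  have hquot : Filter.Tendsto (fun t : ℝ => fun x => Real.exp ((u - t • w) x) /
      ∑ z, Real.exp ((u - t • w) z)) Filter.atTop (nhds p) :=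
    tendsto_pi_nhds.mpr fun x => by
      have := (hlim x).div hsum one_ne_zero
      rwa [div_one] at this
  exact mem_closure_of_tendsto hquot (Filter.Eventually.of_forall fun t =>
    mem_EkBin_of_mem_interactionSpace (Submodule.sub_mem _ hu (Submodule.smul_mem _ t hw)))

open Classical in
theorem sum_paritySign_mul {N : ℕ} (S : Finset (Fin N → Fin 2)) (g : (Fin N → Fin 2) → ℝ) :
    ∑ x ∈ S, paritySign x * g x =
      ∑ x ∈ S with x ∈ Zplus N, g x - ∑ x ∈ S with x ∉ Zplus N, g x := by
  rw [← Finset.sum_filter_add_sum_filter_not S (· ∈ Zplus N), sub_eq_add_neg,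
    ← Finset.sum_neg_distrib]
  congr 1 <;> refine Finset.sum_congr rfl fun x hx => ?_ <;>
    simp [paritySign_eq, (Finset.mem_filter.mp hx).2]

open Classical in
theorem prod_even_eq_prod_odd {k N : ℕ} {lam : Finset (Fin N)} (hlam : k < lam.card)
    (y : Fin N → Fin 2) {p : (Fin N → Fin 2) → ℝ} (hp : p ∈ closure (EkBin N k)) :
    ∏ x ∈ cylinderFinset lam y with x ∈ Zplus N, p x =
      ∏ x ∈ cylinderFinset lam y with x ∉ Zplus N, p x := by
  have hclosed : IsClosed {p : (Fin N → Fin 2) → ℝ |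
      ∏ x ∈ cylinderFinset lam y with x ∈ Zplus N, p x =
        ∏ x ∈ cylinderFinset lam y with x ∉ Zplus N, p x} :=
    isClosed_eq (by fun_prop) (by fun_prop)
  refine closure_minimal (fun q hq => ?_) hclosed hp
  obtain ⟨h, hh, hqh⟩ := exists_mem_interactionSpace_of_mem_EkBin hq
  have := sum_paritySign_mul_eq_zero_of_mem_interactionSpace hlam y hh
  rw [sum_paritySign_mul, sub_eq_zero] at this
  simp only [Set.mem_ofPred_eq, hqh, ← Real.exp_sum, this]

open Classical in
theorem card_even_eq_card_odd {N : ℕ} {lam : Finset (Fin N)} (hlam : lam.Nonempty)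
    (y : Fin N → Fin 2) :
    ((cylinderFinset lam y).filter (· ∈ Zplus N)).card =
      ((cylinderFinset lam y).filter (· ∉ Zplus N)).card := by
  obtain ⟨i, hi⟩ := hlam
  have := sum_paritySign_mul_eq_zero y hi (g := fun _ => 1) fun _ => rfl
  rw [sum_paritySign_mul, sub_eq_zero] at this
  simpa using this

/-- Nonempty finite sets carry a distribution with exactly that support. -/
theorem exists_isDist_support {X : Type*} [Fintype X] {S : Finset X} (hS : S.Nonempty) :
    ∃ p : X → ℝ, IsDist p ∧ ∀ x, 0 < p x ↔ x ∈ S := by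
  classical
  have hc : (0 : ℝ) < S.card := by exact_mod_cast hS.card_pos
  refine ⟨fun x => if x ∈ S then (S.card : ℝ)⁻¹ else 0, ⟨fun x => ?_, ?_⟩, fun x => ?_⟩
  · dsimp only; split_ifs <;> positivity
  · simp [hc.ne']
  · by_cases h : x ∈ S <;> simp [h]
    exact ⟨x, h⟩

open Classical in
theorem not_isSSet_of_support {k N : ℕ} {lam : Finset (Fin N)} (hlam : k < lam.card)
    (y : Fin N → Fin 2) {Z : Set (Fin N → Fin 2)}
    (h : ↑(cylinderFinset lam y) ∩ Zplus N ⊆ Z ∨ ↑(cylinderFinset lam y) ∩ Zminus N ⊆ Z) :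
    ¬ IsSSet (EkBin N k) Z := by
  intro hZ
  have hcard := card_even_eq_card_odd (Finset.card_pos.mp (by omega : 0 < lam.card)) y
  have hadd := Finset.card_filter_add_card_filter_not (s := cylinderFinset lam y) (· ∈ Zplus N)
  have hpos : 0 < (cylinderFinset lam y).card := by rw [card_cylinderFinset]; positivity
  obtain ⟨a, ha⟩ := Finset.card_pos.mp
    (by omega : 0 < ((cylinderFinset lam y).filter (· ∈ Zplus N)).card)
  obtain ⟨b, hb⟩ := Finset.card_pos.mp
    (by omega : 0 < ((cylinderFinset lam y).filter (· ∉ Zplus N)).card)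
  rcases h with h | h
  · obtain ⟨p, hp, hps⟩ := exists_isDist_support ⟨a, ha⟩
    have hprod := prod_even_eq_prod_odd hlam y (hZ p hp fun x hx => by
      have hx' := Finset.mem_filter.mp ((hps x).mp hx)
      exact h ⟨hx'.1, hx'.2⟩)
    rw [Finset.prod_eq_zero hb (le_antisymm (not_lt.mp fun hlt =>
      (Finset.mem_filter.mp hb).2 (Finset.mem_filter.mp ((hps b).mp hlt)).2) (hp.1 b))] at hprod
    exact (Finset.prod_pos fun x hx => (hps x).mpr hx).ne' hprod
  · obtain ⟨p, hp, hps⟩ := exists_isDist_support ⟨b, hb⟩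
    have hprod := prod_even_eq_prod_odd hlam y (hZ p hp fun x hx => by
      have hx' := Finset.mem_filter.mp ((hps x).mp hx)
      exact h ⟨hx'.1, hx'.2⟩)
    rw [Finset.prod_eq_zero ha (le_antisymm (not_lt.mp fun hlt =>
      (Finset.mem_filter.mp ((hps a).mp hlt)).2 (Finset.mem_filter.mp ha).2) (hp.1 a))] at hprod
    exact (Finset.prod_pos fun x hx => (hps x).mpr hx).ne hprod

/-- The number of coordinates outside `lam` in which `x` and `y` differ is a sum of interactions
of order one. -/
theorem offCylinder_mem_interactionSpace {k N : ℕ} (hk : 0 < k) (lam : Finset (Fin N))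
    (y : Fin N → Fin 2) :
    (fun x : Fin N → Fin 2 => ∑ j ∈ lamᶜ, if x j = y j then (0 : ℝ) else 1) ∈
      interactionSpace k N := by
  have : (fun x : Fin N → Fin 2 => ∑ j ∈ lamᶜ, if x j = y j then (0 : ℝ) else 1) =
      ∑ j ∈ lamᶜ, fun x : Fin N → Fin 2 => if x j = y j then (0 : ℝ) else 1 := by
    funext x; simp only [Finset.sum_apply]
  rw [this]
  refine Submodule.sum_mem _ fun j _ => ?_
  have hdep : DependsOnlyOn {j} fun x : Fin N → Fin 2 => if x j = y j then (0 : ℝ) else 1 :=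
    fun a b hab => by simp [hab j (by simp)]
  exact hdep.mem_interactionSpace (by rw [Finset.card_singleton]; exact hk)

open Classical in
theorem isSSet_of_missing {k N : ℕ} (hk : 0 < k) {lam : Finset (Fin N)}
    (hlam : lam.card ≤ k + 1) {y : Fin N → Fin 2} {Z : Set (Fin N → Fin 2)}
    (hZ : Z ⊆ cylinderFinset lam y) {a b : Fin N → Fin 2}
    (ha : a ∈ cylinderFinset lam y) (haP : a ∈ Zplus N) (haZ : a ∉ Z)
    (hb : b ∈ cylinderFinset lam y) (hbP : b ∉ Zplus N) (hbZ : b ∉ Z) :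
    IsSSet (EkBin N k) Z := by
  intro p hp hpZ
  set C := cylinderFinset lam y with hC
  have hpz : ∀ x, x ∉ Z → p x = 0 := fun x hx =>
    le_antisymm (not_lt.mp fun h => hx (hpZ h)) (hp.1 x)
  have hpc : ∀ x, 0 < p x → lam.piecewise x y = x := fun x hx =>
    piecewise_eq_of_mem_cylinderFinset (hZ (hpZ hx))
  have hsa : paritySign a = 1 := by simp [paritySign_eq, haP]
  -- the correction at `a` makes the logarithm orthogonal to the parity character
  let c : ℝ := ∑ x ∈ C, paritySign x * Real.log (p x)
  let u : (Fin N → Fin 2) → ℝ := fun x => Real.log (p x) - if x = a then c else 0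
  have hu : ∑ x ∈ C, paritySign x * u x = 0 := by
    simp only [u, mul_sub, Finset.sum_sub_distrib, mul_ite, mul_zero, Finset.sum_ite_eq', ha,
      if_true, hsa, one_mul]
    exact sub_self c
  let P := C.filter fun x => x ∈ Zplus N ∧ p x = 0
  let M := C.filter fun x => x ∉ Zplus N ∧ p x = 0
  have hPpos : (0 : ℝ) < P.card := by
    exact_mod_cast Finset.card_pos.mpr ⟨a, by simp [P, ha, haP, hpz a haZ]⟩
  have hMpos : (0 : ℝ) < M.card := by
    exact_mod_cast Finset.card_pos.mpr ⟨b, by simp [M, hb, hbP, hpz b hbZ]⟩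
  let v : (Fin N → Fin 2) → ℝ := fun x =>
    if p x = 0 then (if x ∈ Zplus N then (P.card : ℝ)⁻¹ else (M.card : ℝ)⁻¹) else 0
  have hv : ∑ x ∈ C, paritySign x * v x = 0 := by
    have h1 : ∑ x ∈ C with x ∈ Zplus N, v x = 1 := by
      rw [Finset.sum_congr rfl (g := fun x => if p x = 0 then (P.card : ℝ)⁻¹ else 0)
        (fun x hx => by simp [v, (Finset.mem_filter.mp hx).2]), ← Finset.sum_filter,
        Finset.filter_filter, Finset.sum_const, nsmul_eq_mul]
      exact mul_inv_cancel₀ hPpos.ne'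
    have h2 : ∑ x ∈ C with x ∉ Zplus N, v x = 1 := by
      rw [Finset.sum_congr rfl (g := fun x => if p x = 0 then (M.card : ℝ)⁻¹ else 0)
        (fun x hx => by simp [v, (Finset.mem_filter.mp hx).2]), ← Finset.sum_filter,
        Finset.filter_filter, Finset.sum_const, nsmul_eq_mul]
      exact mul_inv_cancel₀ hMpos.ne'
    rw [sum_paritySign_mul, h1, h2, sub_self]
  have hvnn : ∀ x, 0 ≤ v x := fun x => by
    simp only [v]; split_ifs <;> positivity
  refine mem_closure_EkBin hp (comp_piecewise_mem_interactionSpace hlam hu)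
    (Submodule.add_mem _ (comp_piecewise_mem_interactionSpace hlam hv)
      (offCylinder_mem_interactionSpace hk lam y)) (fun x hx => ?_) (fun x hx => ?_)
    (fun x hx => ?_)
  · have : x ≠ a := by rintro rfl; exact hx.ne' (hpz x haZ)
    simp [hpc x hx, u, this]
  · have hxC := mem_cylinderFinset.mp (hZ (hpZ hx))
    simp only [Pi.add_apply, hpc x hx, v, hx.ne', if_false, zero_add]
    exact Finset.sum_eq_zero fun j hj => if_pos (hxC j (Finset.mem_compl.mp hj))
  · by_cases hxC : x ∈ C
    · refine add_pos_of_pos_of_nonneg ?_ (Finset.sum_nonneg fun j _ => by split_ifs <;> simp)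
      simp only [piecewise_eq_of_mem_cylinderFinset hxC, v, hx, if_true]
      split_ifs <;> positivity
    · refine add_pos_of_nonneg_of_pos (hvnn _) ?_
      rw [mem_cylinderFinset] at hxC
      push Not at hxC
      obtain ⟨j, hj, hjy⟩ := hxC
      exact Finset.sum_pos' (fun j _ => by split_ifs <;> simp)
        ⟨j, Finset.mem_compl.mpr hj, by simp [hjy]⟩

theorem isSSet_iff {k N : ℕ} (hk : 0 < k) {lam : Finset (Fin N)} (hlam : lam.card = k + 1)
    {y : Fin N → Fin 2} {Z : Set (Fin N → Fin 2)} (hZ : Z ⊆ cylinderFinset lam y) :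
    IsSSet (EkBin N k) Z ↔ ¬ ↑(cylinderFinset lam y) ∩ Zplus N ⊆ Z ∧
      ¬ ↑(cylinderFinset lam y) ∩ Zminus N ⊆ Z := by
  constructor
  · intro h
    rw [← not_or]
    exact fun h' => not_isSSet_of_support (by omega) y h' h
  · rintro ⟨hP, hM⟩
    obtain ⟨a, ⟨ha, haP⟩, haZ⟩ := Set.not_subset.mp hP
    obtain ⟨b, ⟨hb, hbM⟩, hbZ⟩ := Set.not_subset.mp hM
    exact isSSet_of_missing hk hlam.le hZ ha haP haZ hb hbM hbZ

/-- Removing one point from each of the disjoint parts `A`, `B` of `C` yields all subsets of `C`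
of codimension two that contain neither part. -/
theorem ncard_missing_pairs {X : Type*} [Finite X] {A B C : Set X} (hAB : Disjoint A B)
    (hC : A ∪ B = C) :
    {Z : Set X | Z ⊆ C ∧ (¬ A ⊆ Z ∧ ¬ B ⊆ Z) ∧ Z.ncard = C.ncard - 2}.ncard =
      A.ncard * B.ncard := by
  have hdisj : ∀ x, x ∈ A → x ∉ B := fun x h h' => Set.disjoint_left.mp hAB h h'
  have himage : {Z : Set X | Z ⊆ C ∧ (¬ A ⊆ Z ∧ ¬ B ⊆ Z) ∧ Z.ncard = C.ncard - 2} =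
      (fun q : X × X => C \ {q.1, q.2}) '' (A ×ˢ B) := by
    ext Z
    constructor
    · rintro ⟨hZC, ⟨hA, hB⟩, hcard⟩
      obtain ⟨a, ha, haZ⟩ := Set.not_subset.mp hA
      obtain ⟨b, hb, hbZ⟩ := Set.not_subset.mp hB
      have hab : a ≠ b := by rintro rfl; exact hdisj a ha hb
      have hsub : ({a, b} : Set X) ⊆ C := by
        rw [← hC]
        rintro x (rfl | rfl)
        exacts [Or.inl ha, Or.inr hb]
      have hle : Z ⊆ C \ {a, b} := fun x hx =>
        ⟨hZC hx, by rintro (rfl | rfl); exacts [haZ hx, hbZ hx]⟩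
      refine ⟨(a, b), ⟨ha, hb⟩, (Set.eq_of_subset_of_ncard_le hle ?_).symm⟩
      rw [Set.ncard_sdiff hsub, Set.ncard_pair hab, hcard]
    · rintro ⟨⟨a, b⟩, ⟨ha, hb⟩, rfl⟩
      dsimp only at ha hb ⊢
      have hab : a ≠ b := by rintro rfl; exact hdisj a ha hb
      have hsub : ({a, b} : Set X) ⊆ C := by
        rw [← hC]
        rintro x (rfl | rfl)
        exacts [Or.inl ha, Or.inr hb]
      refine ⟨Set.sdiff_subset, ⟨fun h => (h ha).2 (by simp), fun h => (h hb).2 (by simp)⟩, ?_⟩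
      rw [Set.ncard_sdiff hsub, Set.ncard_pair hab]
  rw [himage, Set.InjOn.ncard_image, Set.ncard_prod]
  rintro ⟨a, b⟩ ⟨ha, hb⟩ ⟨a', b'⟩ ⟨ha', hb'⟩ h
  dsimp only at ha hb ha' hb' h
  have hmem : ∀ x ∈ C, x = a ∨ x = b → x = a' ∨ x = b' := fun x hx hxab => by
    by_contra hne
    have : x ∈ C \ {a', b'} := ⟨hx, hne⟩
    rw [← h] at this
    exact this.2 hxab
  have h1 := hmem a (hC ▸ Or.inl ha) (Or.inl rfl)
  have h2 := hmem b (hC ▸ Or.inr hb) (Or.inr rfl)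
  have h3 : a ≠ b' := by rintro rfl; exact hdisj _ ha hb'
  have h4 : b ≠ a' := by rintro rfl; exact hdisj _ ha' hb
  exact Prod.ext (h1.resolve_right h3) (h2.resolve_left h4)

/-- for a `(k+1)`-dimensional cylinder set `C`, a subset `Z ⊆ C`
is an S-set for `E^k` iff it contains neither `C ∩ Z₊` nor `C ∩ Z₋`;
consequently there are exactly `2^(2k)` S-sets `Z ⊆ C` of cardinality
`2^(k+1) - 2`. -/
theorem stmt_14 (N k : ℕ) (hk : 0 < k) (hkN : k < N)
    (lam : Finset (Fin N)) (hlam : lam.card = k + 1) (y : Fin N → Fin 2) :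
    let C : Set (Fin N → Fin 2) := {x | ∀ j ∉ lam, x j = y j}
    (∀ Z ⊆ C, (IsSSet (EkBin N k) Z ↔
      ¬ C ∩ Zplus N ⊆ Z ∧ ¬ C ∩ Zminus N ⊆ Z)) ∧
    {Z : Set (Fin N → Fin 2) | Z ⊆ C ∧ IsSSet (EkBin N k) Z ∧
      Z.ncard = 2 ^ (k + 1) - 2}.ncard = 2 ^ (2 * k) := by
  classical
  intro C
  have hC : C = ↑(cylinderFinset lam y) := by
    ext x; simp [C, mem_cylinderFinset]
  have hiff : ∀ Z ⊆ C, (IsSSet (EkBin N k) Z ↔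
      ¬ C ∩ Zplus N ⊆ Z ∧ ¬ C ∩ Zminus N ⊆ Z) := by
    intro Z hZ
    rw [hC] at hZ ⊢
    exact isSSet_iff hk hlam hZ
  refine ⟨hiff, ?_⟩
  have hCcard : C.ncard = 2 ^ (k + 1) := by
    rw [hC, Set.ncard_coe_finset, card_cylinderFinset, hlam]
  have hset : {Z : Set (Fin N → Fin 2) | Z ⊆ C ∧ IsSSet (EkBin N k) Z ∧
      Z.ncard = 2 ^ (k + 1) - 2} = {Z | Z ⊆ C ∧ (¬ C ∩ Zplus N ⊆ Z ∧ ¬ C ∩ Zminus N ⊆ Z) ∧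
      Z.ncard = C.ncard - 2} := by
    ext Z
    rw [Set.mem_ofPred_eq, Set.mem_ofPred_eq, hCcard]
    exact and_congr_right fun hZ => and_congr_left' (hiff Z hZ)
  have hdisj : Disjoint (C ∩ Zplus N) (C ∩ Zminus N) :=
    Set.disjoint_left.mpr fun _ h h' => h'.2 h.2
  have hunion : C ∩ Zplus N ∪ C ∩ Zminus N = C := by
    rw [← Set.inter_union_distrib_left]
    exact Set.inter_eq_left.mpr fun x _ => em _
  have hP : C ∩ Zplus N = ↑((cylinderFinset lam y).filter (· ∈ Zplus N)) := by
    ext x; simp [hC]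
  have hM : C ∩ Zminus N = ↑((cylinderFinset lam y).filter (· ∉ Zplus N)) := by
    ext x; simp [hC, Zminus, Zplus]
  have heq : (C ∩ Zplus N).ncard = (C ∩ Zminus N).ncard := by
    rw [hP, hM, Set.ncard_coe_finset, Set.ncard_coe_finset]
    exact card_even_eq_card_odd (Finset.card_pos.mp (by omega)) y
  have hadd := Set.ncard_union_eq hdisj
  rw [hunion, hCcard, ← heq, pow_succ] at hadd
  rw [hset, ncard_missing_pairs hdisj hunion, ← heq,
    show (C ∩ Zplus N).ncard = 2 ^ k by omega, two_mul, pow_add]
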